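/- Let D ⊂ R^n (n ≥ 2) be a bounded domain with C^2 boundary and p ∈ [1,∞). Then there exists a constant C = C_D such that ‖φ - (φ)‖_{L^p(D)} ≤ C sup_{x∈D} d_D(x)|∇φ(x)| for all φ ∈ Ŵ^{1,∞}_d(D), where (φ) denotes the mean value of φ over D. -/

import Mathlib

open Metric MeasureTheory

noncomputable section

/-- A local graph representation of the boundary: near `x₀`, after a rotation `e`,
`Ω` coincides with the region above the graph of a `C^k` function `h` with `C^k`
norm at most `K`. -/
def IsCkGraphAt (n k : ℕ) (Ω : Set (EuclideanSpace ℝ (Fin n))) (α β K : ℝ)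
    (x₀ : EuclideanSpace ℝ (Fin n)) : Prop :=
  ∃ (e : EuclideanSpace ℝ (Fin n) ≃ₗᵢ[ℝ] WithLp 2 (EuclideanSpace ℝ (Fin (n - 1)) × ℝ))
    (h : EuclideanSpace ℝ (Fin (n - 1)) → ℝ),
    ContDiffOn ℝ (k : ℕ∞) h (ball 0 α) ∧ h 0 = 0 ∧
    fderivWithin ℝ h (ball 0 α) 0 = 0 ∧
    (∀ m : ℕ, m ≤ k → ∀ y' ∈ ball (0 : EuclideanSpace ℝ (Fin (n - 1))) α,
      ‖iteratedFDerivWithin ℝ m h (ball 0 α) y'‖ ≤ K) ∧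
    ∀ (y' : EuclideanSpace ℝ (Fin (n - 1))) (t : ℝ), ‖y'‖ < α → |t| < β →
      (x₀ + e.symm ((WithLp.equiv 2 (EuclideanSpace ℝ (Fin (n - 1)) × ℝ)).symm
        (y', h y' + t)) ∈ Ω ↔ 0 < t)

/-- A bounded domain (open connected bounded set) with `C^k` boundary. -/
def IsBoundedCkDomain (n k : ℕ) (D : Set (EuclideanSpace ℝ (Fin n))) : Prop :=
  IsOpen D ∧ IsConnected D ∧ Bornology.IsBounded D ∧
  ∀ x₀ ∈ frontier D, ∃ α > (0:ℝ), ∃ β > (0:ℝ), ∃ K : ℝ, IsCkGraphAt n k D α β K x₀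

/-- A uniformly `C^k` domain: graph representations with uniform constants `α, β, K`. -/
def IsUniformlyCkDomain (n k : ℕ) (Ω : Set (EuclideanSpace ℝ (Fin n))) : Prop :=
  IsOpen Ω ∧ IsConnected Ω ∧
  ∃ α > (0:ℝ), ∃ β > (0:ℝ), ∃ K : ℝ, ∀ x₀ ∈ frontier Ω, IsCkGraphAt n k Ω α β K x₀

end

/-- `φ` is differentiable on `D` and `dist(x, ∂D) ‖∇φ(x)‖ ≤ L` for every `x ∈ D`. -/
def HasWeightedGradientBound {E : Type*} [NormedAddCommGroup E] [NormedSpace ℝ E]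
    (D : Set E) (φ : E → ℝ) (L : ℝ) : Prop :=
  DifferentiableOn ℝ φ D ∧ ∀ x ∈ D, infDist x (frontier D) * ‖fderivWithin ℝ φ D x‖ ≤ L

namespace HasWeightedGradientBound

variable {E : Type*} [NormedAddCommGroup E] [NormedSpace ℝ E] {D : Set E} {φ : E → ℝ} {L : ℝ}

lemma nonneg (hφ : HasWeightedGradientBound D φ L) (hne : D.Nonempty) : 0 ≤ L := by
  obtain ⟨x, hx⟩ := hne
  exact (mul_nonneg infDist_nonneg (norm_nonneg _)).trans (hφ.2 x hx)

lemma norm_fderiv_le (hφ : HasWeightedGradientBound D φ L) (hD : IsOpen D)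
    (hfr : (frontier D).Nonempty) {x : E} {r : ℝ} (hr : 0 < r) (hball : ball x r ⊆ D) :
    ‖fderiv ℝ φ x‖ ≤ L / r := by
  have hx : x ∈ D := hball (mem_ball_self hr)
  have hle : r ≤ infDist x (frontier D) := by
    refine (le_infDist hfr).2 fun y hy => ?_
    by_contra! hlt
    exact (disjoint_frontier_iff_isOpen.2 hD).symm.ne_of_mem (hball (mem_ball'.2 hlt)) hy rfl
  have h := hφ.2 x hx
  rw [fderivWithin_of_isOpen hD hx] at h
  rw [le_div_iff₀ hr, mul_comm]
  exact (mul_le_mul_of_nonneg_right hle (norm_nonneg _)).trans h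

lemma abs_sub_le_of_mem_ball (hφ : HasWeightedGradientBound D φ L) (hD : IsOpen D)
    (hfr : (frontier D).Nonempty) {z w : E} {r : ℝ} (hr : 0 < r) (hball : ball z r ⊆ D)
    (hw : w ∈ ball z (r / 2)) : |φ w - φ z| ≤ L := by
  have hr2 : 0 < r / 2 := half_pos hr
  have hsub : ∀ x ∈ ball z (r / 2), ball x (r / 2) ⊆ D := fun x hx =>
    (ball_subset_ball' (by rw [mem_ball] at hx; linarith)).trans hball
  have h := (convex_ball z (r / 2)).norm_image_sub_le_of_norm_fderiv_le (𝕜 := ℝ) (f := φ)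
    (fun x hx => (hφ.1 x (hsub x hx (mem_ball_self hr2))).differentiableAt
      (hD.mem_nhds (hsub x hx (mem_ball_self hr2))))
    (fun x hx => hφ.norm_fderiv_le hD hfr hr2 (hsub x hx)) (mem_ball_self hr2) hw
  have hL := hφ.nonneg ⟨z, hball (mem_ball_self hr)⟩
  rw [mem_ball, dist_eq_norm] at hw
  calc |φ w - φ z| ≤ L / (r / 2) * ‖w - z‖ := h
    _ ≤ L / (r / 2) * (r / 2) := by gcongr
    _ = L := by field_simp

/-- Integrating the weighted gradient bound along a segment on which the distance to the
boundary grows linearly. -/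
lemma abs_sub_le_log (hφ : HasWeightedGradientBound D φ L) (hD : IsOpen D)
    (hfr : (frontier D).Nonempty) {a v : E} (hv : ‖v‖ ≤ 1) {c t T : ℝ} (hc : 0 < c) (ht : 0 < t)
    (htT : t ≤ T) (hball : ∀ s ∈ Set.Icc t T, ball (a + s • v) (c * s) ⊆ D) :
    |φ (a + T • v) - φ (a + t • v)| ≤ L / c * Real.log (T / t) := by
  have hpos : ∀ s ∈ Set.Icc t T, 0 < s := fun s hs => ht.trans_le hs.1
  have hmem : ∀ s ∈ Set.Icc t T, a + s • v ∈ D := fun s hs =>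
    hball s hs (mem_ball_self (mul_pos hc (hpos s hs)))
  have hline : ∀ s ∈ Set.Icc t T, HasDerivAt (fun s : ℝ => φ (a + s • v) - φ (a + t • v))
      (fderiv ℝ φ (a + s • v) v) s := by
    intro s hs
    have h1 : HasDerivAt (fun s : ℝ => a + s • v) v s := by
      simpa using ((hasDerivAt_id s).smul_const v).const_add a
    have h2 := ((hφ.1 _ (hmem s hs)).differentiableAt (hD.mem_nhds (hmem s hs))).hasFDerivAt
    exact (h2.comp_hasDerivAt s h1).sub_const _
  have hlog : ∀ s ∈ Set.Icc t T,
      HasDerivAt (fun s : ℝ => L / c * (Real.log s - Real.log t)) (L / c * s⁻¹) s := fun s hs =>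
    ((Real.hasDerivAt_log (hpos s hs).ne').sub_const _).const_mul _
  have h := image_norm_le_of_norm_deriv_right_le_deriv_boundary'
    (fun s hs => (hline s hs).continuousAt.continuousWithinAt)
    (fun s hs => (hline s (Set.Ico_subset_Icc_self hs)).hasDerivWithinAt)
    (B := fun s : ℝ => L / c * (Real.log s - Real.log t)) (by simp)
    (fun s hs => (hlog s hs).continuousAt.continuousWithinAt)
    (fun s hs => (hlog s (Set.Ico_subset_Icc_self hs)).hasDerivWithinAt)
    (fun s hs => ?_) (Set.right_mem_Icc.2 htT)
  · rwa [Real.log_div (ht.trans_le htT).ne' ht.ne']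
  · have hs' := Set.Ico_subset_Icc_self hs
    have hg := hφ.norm_fderiv_le hD hfr (mul_pos hc (hpos s hs')) (hball s hs')
    calc ‖fderiv ℝ φ (a + s • v) v‖ ≤ ‖fderiv ℝ φ (a + s • v)‖ * ‖v‖ :=
          ContinuousLinearMap.le_opNorm _ _
      _ ≤ ‖fderiv ℝ φ (a + s • v)‖ * 1 := by gcongr
      _ ≤ L / (c * s) := by rwa [mul_one]
      _ = L / c * s⁻¹ := by rw [div_mul_eq_div_div, div_eq_mul_inv (L / c)]

end HasWeightedGradientBound

/-- On a connected open set, the oscillation between two fixed points is controlled by the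
weighted gradient bound, with a constant independent of the function. -/
lemma exists_forall_abs_sub_le {E : Type*} [NormedAddCommGroup E] [NormedSpace ℝ E] {D : Set E}
    (hD : IsOpen D) (hconn : IsPreconnected D) (hfr : (frontier D).Nonempty) {x y : E}
    (hx : x ∈ D) (hy : y ∈ D) :
    ∃ C : ℝ, 0 ≤ C ∧ ∀ φ L, HasWeightedGradientBound D φ L → |φ x - φ y| ≤ C * L := by
  refine hconn.induction₂ (fun x y => ∃ C : ℝ, 0 ≤ C ∧
    ∀ φ L, HasWeightedGradientBound D φ L → |φ x - φ y| ≤ C * L) ?_ ?_ ?_ hx hy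
  · intro z hz
    obtain ⟨r, hr, hball⟩ := Metric.isOpen_iff.1 hD z hz
    filter_upwards [mem_nhdsWithin_of_mem_nhds (ball_mem_nhds z (half_pos hr))] with w hw
    refine ⟨1, zero_le_one, fun φ L hφ => ?_⟩
    rw [one_mul, abs_sub_comm]
    exact hφ.abs_sub_le_of_mem_ball hD hfr hr hball hw
  · rintro x y z - - - ⟨C₁, h₁, H₁⟩ ⟨C₂, h₂, H₂⟩
    refine ⟨C₁ + C₂, add_nonneg h₁ h₂, fun φ L hφ => ?_⟩
    rw [add_mul]
    exact (abs_sub_le _ _ _).trans (add_le_add (H₁ φ L hφ) (H₂ φ L hφ))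
  · rintro x y - - ⟨C, h, H⟩
    exact ⟨C, h, fun φ L hφ => by rw [abs_sub_comm]; exact H φ L hφ⟩

/-- Near a Lipschitz graph, the distance to the complement of the epigraph grows linearly with
the vertical distance to the graph. -/
lemma ball_subset_of_graph {E F : Type*} [NormedAddCommGroup E] [NormedSpace ℝ E]
    [NormedAddCommGroup F] [NormedSpace ℝ F] (e : E ≃ₗᵢ[ℝ] WithLp 2 (F × ℝ)) {h : F → ℝ}
    {D : Set E} {x₀ : E} {α β K : ℝ} (hK : 0 ≤ K)
    (hlip : ∀ y ∈ ball (0 : F) α, ∀ z ∈ ball (0 : F) α, |h z - h y| ≤ K * ‖z - y‖)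
    (hgraph : ∀ (y : F) (t : ℝ), ‖y‖ < α → |t| < β →
      (x₀ + e.symm (WithLp.toLp 2 (y, h y + t)) ∈ D ↔ 0 < t))
    {y : F} {t : ℝ} (hy : ‖y‖ < α / 2) (ht : 0 < t) (htα : t ≤ α / 4) (htβ : t ≤ β / 4) :
    ball (x₀ + e.symm (WithLp.toLp 2 (y, h y + t))) ((2 * (1 + K))⁻¹ * t) ⊆ D := by
  intro z hz
  obtain ⟨⟨y', s⟩, hys⟩ : ∃ q : F × ℝ, z = x₀ + e.symm (WithLp.toLp 2 q) :=
    ⟨(e (z - x₀)).ofLp, by simp⟩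
  set δ := (2 * (1 + K))⁻¹ * t
  have hδ : (1 + K) * δ = t / 2 := by simp only [δ]; field_simp
  have hdist : ‖WithLp.toLp 2 (y' - y, s - (h y + t))‖ < δ := by
    rw [mem_ball, hys, dist_add_left, e.symm.dist_map, dist_eq_norm] at hz
    exact hz
  have h1 : ‖y' - y‖ < δ := (WithLp.norm_fst_le _ _).trans_lt hdist
  have h2 : |s - (h y + t)| < δ := (WithLp.norm_snd_le _ _).trans_lt hdist
  have hδ0 : 0 < δ := (norm_nonneg _).trans_lt h1
  have hKδ : 0 ≤ K * δ := mul_nonneg hK hδ0.le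
  have hy' : ‖y'‖ < α := by
    have := norm_le_norm_add_norm_sub' y' y
    nlinarith
  have h3 := hlip y (by simpa using hy.trans_le (by linarith [norm_nonneg y])) y' (by simpa using hy')
  have h4 : K * ‖y' - y‖ ≤ K * δ := by gcongr
  rw [abs_lt] at h2
  rw [abs_le] at h3
  have key := (hgraph y' (s - h y') hy' (by rw [abs_lt]; constructor <;> linarith)).2
    (by linarith)
  rw [hys]
  simpa using key

lemma lintegral_prod_shear {F : Type*} [MeasurableSpace F] (μ : Measure F) [SFinite μ] {s : Set F}
    (hs : MeasurableSet s) {h : F → ℝ} (hh : Measurable h) {f : ℝ → ENNReal} (hf : Measurable f) :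
    ∫⁻ q : F × ℝ, s.indicator 1 q.1 * f (q.2 - h q.1) ∂(μ.prod volume)
      = μ s * ∫⁻ t, f t := by
  have hs1 : Measurable (s.indicator (1 : F → ENNReal)) := measurable_one.indicator hs
  rw [lintegral_prod _ (by fun_prop)]
  have : ∀ y : F, ∫⁻ t, s.indicator 1 y * f (t - h y) = s.indicator 1 y * ∫⁻ t, f t := fun y => by
    rw [lintegral_const_mul _ (by fun_prop), lintegral_sub_right_eq_self f (h y)]
  simp only [this]
  rw [lintegral_mul_const _ hs1, lintegral_indicator_one hs]

lemma lintegral_Ioo_rpow_div_ne_top {T r : ℝ} (hT : 0 < T) (hr : r < 1) :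
    ∫⁻ t in Set.Ioo 0 T, ENNReal.ofReal ((T / t) ^ r) ≠ ⊤ := by
  have hint : IntegrableOn (fun t : ℝ => T ^ r * t ^ (-r)) (Set.Ioo 0 T) :=
    ((intervalIntegral.integrableOn_Ioo_rpow_iff hT).2 (by linarith)).const_mul _
  rw [setLIntegral_congr_fun (g := fun t => ENNReal.ofReal (T ^ r * t ^ (-r))) measurableSet_Ioo
    fun t ht => by
      simp only
      rw [Real.div_rpow hT.le ht.1.le, Real.rpow_neg ht.1.le, div_eq_mul_inv]]
  exact hint.lintegral_lt_top.ne

/-- The logarithmic growth of `φ` at a Lipschitz boundary point is locally `p`-integrable. -/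
lemma exists_nhds_lintegral_le_of_graph {E F : Type*}
    [NormedAddCommGroup E] [InnerProductSpace ℝ E] [FiniteDimensional ℝ E]
    [MeasurableSpace E] [BorelSpace E]
    [NormedAddCommGroup F] [InnerProductSpace ℝ F] [FiniteDimensional ℝ F]
    [MeasurableSpace F] [BorelSpace F]
    (e : E ≃ₗᵢ[ℝ] WithLp 2 (F × ℝ)) {h : F → ℝ}
    {D : Set E} {x₀ x₁ : E} {α β K p : ℝ} (hα : 0 < α) (hβ : 0 < β) (hK : 0 ≤ K)
    (hcont : ContinuousOn h (ball 0 α)) (h0 : h 0 = 0)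
    (hlip : ∀ y ∈ ball (0 : F) α, ∀ z ∈ ball (0 : F) α, |h z - h y| ≤ K * ‖z - y‖)
    (hgraph : ∀ (y : F) (t : ℝ), ‖y‖ < α → |t| < β →
      (x₀ + e.symm (WithLp.toLp 2 (y, h y + t)) ∈ D ↔ 0 < t))
    (hD : IsOpen D) (hconn : IsPreconnected D) (hfr : (frontier D).Nonempty) (hx₁ : x₁ ∈ D)
    (hp : 1 ≤ p) :
    ∃ V ∈ nhds x₀, ∃ C : ENNReal, C ≠ ⊤ ∧ ∀ φ L, HasWeightedGradientBound D φ L →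
      ∫⁻ x in V ∩ D, ‖φ x - φ x₁‖ₑ ^ p ≤ C * ENNReal.ofReal L ^ p := by
  have hp0 : 0 < p := one_pos.trans_le hp
  obtain ⟨T, hT, hTα, hTβ⟩ : ∃ T : ℝ, 0 < T ∧ T ≤ α / 4 ∧ T ≤ β / 4 :=
    ⟨min (α / 4) (β / 4), by positivity, min_le_left _ _, min_le_right _ _⟩
  set c : ℝ := (2 * (1 + K))⁻¹ with hc_def
  have hc : 0 < c := by positivity
  set P : F → ℝ → E := fun y t => x₀ + e.symm (WithLp.toLp 2 (y, h y + t)) with hP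
  have hball : ∀ y t, ‖y‖ < α / 2 → 0 < t → t ≤ T → ball (P y t) (c * t) ⊆ D :=
    fun y t hy ht htT => ball_subset_of_graph e hK hlip hgraph hy ht (htT.trans hTα)
      (htT.trans hTβ)
  set Ψ : E → F × ℝ := fun x => (e (x - x₀)).ofLp with hΨ
  have hΨcont : Continuous Ψ :=
    (WithLp.prod_continuous_ofLp 2 F ℝ).comp (e.continuous.comp (continuous_id.sub continuous_const))
  have hΨ0 : Ψ x₀ = 0 := by simp [Ψ]
  have hPΨ : ∀ x, P (Ψ x).1 ((Ψ x).2 - h (Ψ x).1) = x := fun x => by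
    simp only [hP, add_sub_cancel]
    change x₀ + e.symm (e (x - x₀)) = x
    simp
  set v : E := e.symm (WithLp.toLp 2 ((0 : F), (1 : ℝ))) with hv_def
  have hv : ‖v‖ ≤ 1 := by
    rw [hv_def, e.symm.norm_map]; simp
  have hline : ∀ y s, P y s = P y 0 + s • v := fun y s => by
    simp only [hP, hv_def, add_assoc, ← map_smul, ← map_add, ← WithLp.toLp_smul, ← WithLp.toLp_add]
    simp
  have hq : P 0 T ∈ D := hball 0 T (by simpa using hα) hT le_rfl (mem_ball_self (by positivity))
  obtain ⟨C₀, hC₀, hC₀φ⟩ := exists_forall_abs_sub_le hD hconn hfr hq hx₁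
  set V : Set E := {x | ‖(Ψ x).1‖ < α / 2 ∧ |(Ψ x).2 - h (Ψ x).1| < T ∧
    P (Ψ x).1 T ∈ ball (P 0 T) (c * T / 2)} with hV_def
  have hhΨ : ContinuousAt (fun x => h (Ψ x).1) x₀ := by
    refine ContinuousAt.comp (f := fun x => (Ψ x).1) ?_ hΨcont.fst.continuousAt
    rw [hΨ0]
    exact hcont.continuousAt (ball_mem_nhds _ hα)
  have hV : V ∈ nhds x₀ := by
    refine Filter.inter_mem ?_ (Filter.inter_mem ?_ ?_)
    · exact hΨcont.fst.norm.continuousAt.eventually_lt continuousAt_const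
        (by simpa [hΨ0] using hα)
    · exact (hΨcont.snd.continuousAt.sub hhΨ).abs.eventually_lt continuousAt_const
        (by simpa [hΨ0, h0] using hT)
    · have hcP : ContinuousAt (fun x => P (Ψ x).1 T) x₀ := by
        refine continuousAt_const.add (e.symm.continuous.continuousAt.comp
          ((WithLp.prod_continuous_toLp 2 F ℝ).continuousAt.comp
            (hΨcont.fst.continuousAt.prodMk (hhΨ.add continuousAt_const))))
      have hmem : ball (P 0 T) (c * T / 2) ∈ nhds (P (Ψ x₀).1 T) := by
        rw [hΨ0]
        exact ball_mem_nhds _ (by positivity)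
      exact hcP hmem
  set ε : ℝ := (2 * p)⁻¹ with hε_def
  have hε : 0 < ε := by positivity
  set A : ℝ := 1 / (c * ε) + 1 + C₀ with hA_def
  have hA : 0 ≤ A := by positivity
  classical
  set g : F → ℝ := (ball (0 : F) α).piecewise h 0 with hg_def
  have hg : Measurable g := hcont.measurable_piecewise continuousOn_const measurableSet_ball
  set f : ℝ → ENNReal := (Set.Ioo 0 T).indicator fun t => ENNReal.ofReal ((T / t) ^ (1 / 2 : ℝ))
    with hf_def
  have hf : Measurable f := Measurable.indicator (by fun_prop) measurableSet_Ioo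
  have hpoint : ∀ φ L, HasWeightedGradientBound D φ L → ∀ x ∈ V ∩ D,
      ‖φ x - φ x₁‖ₑ ^ p ≤ ENNReal.ofReal (A * L) ^ p *
        ((ball (0 : F) α).indicator 1 (Ψ x).1 * f ((Ψ x).2 - g (Ψ x).1)) := by
    rintro φ L hφ x ⟨⟨hy, ht, hqx⟩, hxD⟩
    have hL : 0 ≤ L := hφ.nonneg ⟨x₁, hx₁⟩
    have hyα : (Ψ x).1 ∈ ball (0 : F) α := by simpa using hy.trans (half_lt_self hα)
    have hgh : g (Ψ x).1 = h (Ψ x).1 := Set.piecewise_eq_of_mem _ _ _ hyα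
    have hx := hPΨ x
    rw [hgh, Set.indicator_of_mem hyα]
    generalize (Ψ x).2 - h (Ψ x).1 = t at ht hx ⊢
    generalize (Ψ x).1 = y at hy hqx hyα hx
    have ht0 : 0 < t := (hgraph y t (by simpa using hyα) (by linarith)).1 (by
      rw [← hx] at hxD; exact hxD)
    have htT : t < T := (abs_lt.1 ht).2
    have h1 : |φ (P y T) - φ x| ≤ L / c * Real.log (T / t) := by
      rw [← hx, hline y T, hline y t]
      refine hφ.abs_sub_le_log hD hfr hv hc ht0 htT.le fun s hs => ?_
      rw [← hline]
      exact hball y s hy (ht0.trans_le hs.1) hs.2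
    have h2 : |φ (P y T) - φ (P 0 T)| ≤ L :=
      hφ.abs_sub_le_of_mem_ball hD hfr (mul_pos hc hT) (hball 0 T (by simpa using hα) hT le_rfl) hqx
    have h3 := hC₀φ φ L hφ
    have hu : 1 ≤ (T / t) ^ ε := Real.one_le_rpow ((one_le_div ht0).2 htT.le) hε.le
    have hlog : Real.log (T / t) ≤ (T / t) ^ ε / ε := Real.log_le_rpow_div (by positivity) hε
    have h4 : |φ x - φ x₁| ≤ A * L * (T / t) ^ ε := by
      have h5 : |φ x - φ x₁| ≤ |φ (P y T) - φ x| + |φ (P y T) - φ (P 0 T)| +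
          |φ (P 0 T) - φ x₁| := by
        rw [abs_sub_comm (φ (P y T)) (φ x)]
        exact (abs_sub_le _ (φ (P 0 T)) _).trans (add_le_add (abs_sub_le _ _ _) le_rfl)
      calc |φ x - φ x₁| ≤ L / c * ((T / t) ^ ε / ε) + L * 1 + C₀ * L * 1 := by
            rw [mul_one, mul_one]
            have : L / c * Real.log (T / t) ≤ L / c * ((T / t) ^ ε / ε) := by gcongr
            linarith
        _ ≤ L / c * ((T / t) ^ ε / ε) + L * (T / t) ^ ε + C₀ * L * (T / t) ^ ε := by gcongr
        _ = A * L * (T / t) ^ ε := by rw [hA_def]; field_simp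
    rw [Pi.one_apply, one_mul, hf_def, Set.indicator_of_mem (Set.mem_Ioo.2 ⟨ht0, htT⟩),
      Real.enorm_eq_ofReal_abs]
    have hpow : ((T / t) ^ (1 / 2 : ℝ)) = ((T / t) ^ ε) ^ p := by
      rw [← Real.rpow_mul (by positivity), hε_def]
      congr 1
      field_simp
    rw [hpow, ← ENNReal.ofReal_rpow_of_nonneg (by positivity) hp0.le,
      ← ENNReal.mul_rpow_of_nonneg _ _ hp0.le, ← ENNReal.ofReal_mul (by positivity)]
    gcongr
  refine ⟨V, hV, ENNReal.ofReal A ^ p * (volume (ball (0 : F) α) * ∫⁻ t, f t), ?_, ?_⟩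
  · refine ENNReal.mul_ne_top (ENNReal.rpow_ne_top_of_nonneg hp0.le ENNReal.ofReal_ne_top)
      (ENNReal.mul_ne_top measure_ball_lt_top.ne ?_)
    rw [hf_def, lintegral_indicator measurableSet_Ioo]
    exact lintegral_Ioo_rpow_div_ne_top hT (by norm_num)
  · intro φ L hφ
    have hmp : MeasurePreserving Ψ (volume : Measure E) (volume.prod volume) :=
      (WithLp.volume_preserving_ofLp F ℝ).comp
        (e.measurePreserving.comp (measurePreserving_sub_right volume x₀))
    have hGm : Measurable fun q : F × ℝ =>
        (ball (0 : F) α).indicator (1 : F → ENNReal) q.1 * f (q.2 - g q.1) :=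
      ((measurable_one.indicator measurableSet_ball).comp measurable_fst).mul
        (hf.comp (measurable_snd.sub (hg.comp measurable_fst)))
    have hGΨ : Measurable fun x =>
        (ball (0 : F) α).indicator (1 : F → ENNReal) (Ψ x).1 * f ((Ψ x).2 - g (Ψ x).1) :=
      hGm.comp hΨcont.measurable
    calc ∫⁻ x in V ∩ D, ‖φ x - φ x₁‖ₑ ^ p
        ≤ ∫⁻ x in V ∩ D, ENNReal.ofReal (A * L) ^ p *
            ((ball (0 : F) α).indicator 1 (Ψ x).1 * f ((Ψ x).2 - g (Ψ x).1)) :=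
          setLIntegral_mono (hGΨ.const_mul _) (hpoint φ L hφ)
      _ ≤ ∫⁻ x, ENNReal.ofReal (A * L) ^ p *
            ((ball (0 : F) α).indicator 1 (Ψ x).1 * f ((Ψ x).2 - g (Ψ x).1)) :=
          setLIntegral_le_lintegral _ _
      _ = ENNReal.ofReal (A * L) ^ p * (volume (ball (0 : F) α) * ∫⁻ t, f t) := by
          rw [lintegral_const_mul _ hGΨ,
            hmp.lintegral_comp hGm, lintegral_prod_shear volume measurableSet_ball hg hf]
      _ = _ := by
          rw [ENNReal.ofReal_mul hA, ENNReal.mul_rpow_of_nonneg _ _ hp0.le]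
          ring

lemma IsCkGraphAt.exists_nhds_lintegral_le {n k : ℕ} (hk : 1 ≤ k)
    {D : Set (EuclideanSpace ℝ (Fin n))} {α β K p : ℝ} {x₀ x₁ : EuclideanSpace ℝ (Fin n)}
    (hα : 0 < α) (hβ : 0 < β) (hx₀ : IsCkGraphAt n k D α β K x₀)
    (hD : IsOpen D) (hconn : IsPreconnected D) (hfr : (frontier D).Nonempty) (hx₁ : x₁ ∈ D)
    (hp : 1 ≤ p) :
    ∃ V ∈ nhds x₀, ∃ C : ENNReal, C ≠ ⊤ ∧ ∀ φ L, HasWeightedGradientBound D φ L →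
      ∫⁻ x in V ∩ D, ‖φ x - φ x₁‖ₑ ^ p ≤ C * ENNReal.ofReal L ^ p := by
  obtain ⟨e, h, hsmooth, h0, -, hbound, hgraph⟩ := hx₀
  have hK : 0 ≤ K := (norm_nonneg _).trans (hbound 0 (Nat.zero_le k) 0 (mem_ball_self hα))
  refine exists_nhds_lintegral_le_of_graph e hα hβ hK hsmooth.continuousOn h0
    (fun y hy z hz => ?_) hgraph hD hconn hfr hx₁ hp
  refine (convex_ball (0 : EuclideanSpace ℝ (Fin (n - 1))) α).norm_image_sub_le_of_norm_fderivWithin_le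
    (𝕜 := ℝ) (hsmooth.differentiableOn ?_) (fun w hw => ?_) hy hz
  · have : (k : WithTop ℕ∞) ≠ 0 := by exact_mod_cast (by omega : k ≠ 0)
    exact this
  · rw [← norm_iteratedFDerivWithin_one h (isOpen_ball.uniqueDiffWithinAt hw)]
    exact hbound 1 hk w hw

lemma IsBoundedCkDomain.exists_lintegral_le {n k : ℕ} (hk : 1 ≤ k)
    {D : Set (EuclideanSpace ℝ (Fin n))} (hD : IsBoundedCkDomain n k D)
    (hfr : (frontier D).Nonempty) {x₁ : EuclideanSpace ℝ (Fin n)} (hx₁ : x₁ ∈ D)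
    {p : ℝ} (hp : 1 ≤ p) :
    ∃ C : ENNReal, C ≠ ⊤ ∧ ∀ φ L, HasWeightedGradientBound D φ L →
      ∫⁻ x in D, ‖φ x - φ x₁‖ₑ ^ p ≤ C * ENNReal.ofReal L ^ p := by
  obtain ⟨hopen, hconn, hbdd, hgraph⟩ := hD
  have hp0 : 0 ≤ p := zero_le_one.trans hp
  suffices H : ∃ C : ENNReal, C ≠ ⊤ ∧ ∀ φ L, HasWeightedGradientBound D φ L →
      ∫⁻ x in closure D ∩ D, ‖φ x - φ x₁‖ₑ ^ p ≤ C * ENNReal.ofReal L ^ p by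
    rwa [Set.inter_eq_right.2 subset_closure] at H
  refine hbdd.isCompact_closure.induction_on (p := fun s => ∃ C : ENNReal, C ≠ ⊤ ∧
    ∀ φ L, HasWeightedGradientBound D φ L →
      ∫⁻ x in s ∩ D, ‖φ x - φ x₁‖ₑ ^ p ≤ C * ENNReal.ofReal L ^ p) ?_ ?_ ?_ ?_
  · exact ⟨0, ENNReal.zero_ne_top, fun φ L _ => by simp⟩
  · rintro s t hst ⟨C, hC, H⟩
    exact ⟨C, hC, fun φ L hφ =>
      (lintegral_mono_set (Set.inter_subset_inter_left _ hst)).trans (H φ L hφ)⟩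
  · rintro s t ⟨C₁, h₁, H₁⟩ ⟨C₂, h₂, H₂⟩
    refine ⟨C₁ + C₂, ENNReal.add_ne_top.2 ⟨h₁, h₂⟩, fun φ L hφ => ?_⟩
    rw [Set.union_inter_distrib_right, add_mul]
    exact (lintegral_union_le _ _ _).trans (add_le_add (H₁ φ L hφ) (H₂ φ L hφ))
  · intro x hx
    by_cases hxD : x ∈ D
    · obtain ⟨r, hr, hball⟩ := Metric.isOpen_iff.1 hopen x hxD
      obtain ⟨C₀, hC₀, hC₀φ⟩ := exists_forall_abs_sub_le hopen hconn.isPreconnected hfr hxD hx₁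
      refine ⟨ball x (r / 2), mem_nhdsWithin_of_mem_nhds (ball_mem_nhds x (half_pos hr)),
        ENNReal.ofReal (1 + C₀) ^ p * volume (ball x (r / 2)),
        ENNReal.mul_ne_top (ENNReal.rpow_ne_top_of_nonneg hp0 ENNReal.ofReal_ne_top)
          measure_ball_lt_top.ne, fun φ L hφ => ?_⟩
      calc ∫⁻ w in ball x (r / 2) ∩ D, ‖φ w - φ x₁‖ₑ ^ p
          ≤ ∫⁻ _ in ball x (r / 2) ∩ D, ENNReal.ofReal ((1 + C₀) * L) ^ p := by
            refine setLIntegral_mono measurable_const fun w hw => ?_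
            rw [Real.enorm_eq_ofReal_abs]
            gcongr
            rw [add_mul, one_mul]
            exact (abs_sub_le _ (φ x) _).trans (add_le_add
              (hφ.abs_sub_le_of_mem_ball hopen hfr hr hball hw.1) (hC₀φ φ L hφ))
        _ ≤ ENNReal.ofReal ((1 + C₀) * L) ^ p * volume (ball x (r / 2)) := by
            rw [setLIntegral_const]
            gcongr
            exact Set.inter_subset_left
        _ = _ := by
            rw [ENNReal.ofReal_mul (by positivity), ENNReal.mul_rpow_of_nonneg _ _ hp0]
            ring
    · have hxf : x ∈ frontier D := by rw [hopen.frontier_eq]; exact ⟨hx, hxD⟩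
      obtain ⟨α, hα, β, hβ, K, hx₀⟩ := hgraph x hxf
      obtain ⟨V, hV, H⟩ := hx₀.exists_nhds_lintegral_le hk hα hβ hopen hconn.isPreconnected hfr
        hx₁ hp
      exact ⟨V, mem_nhdsWithin_of_mem_nhds hV, H⟩

lemma IsBoundedCkDomain.frontier_nonempty {n k : ℕ} (hn : n ≠ 0)
    {D : Set (EuclideanSpace ℝ (Fin n))} (hD : IsBoundedCkDomain n k D) :
    (frontier D).Nonempty := by
  have : Nonempty (Fin n) := Fin.pos_iff_nonempty.1 (Nat.pos_of_ne_zero hn)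
  rw [Set.nonempty_iff_ne_empty, Ne, frontier_eq_empty_iff, not_or]
  refine ⟨hD.2.1.nonempty.ne_empty, ?_⟩
  rintro rfl
  exact NormedSpace.unbounded_univ ℝ _ hD.2.2.1

/-- The `L^p` distance to the mean is controlled by the `L^p` and `L^1` distances to any
constant. -/
lemma eLpNorm_sub_average_le {X : Type*} [MeasurableSpace X] {μ : Measure X} [IsFiniteMeasure μ]
    [NeZero μ] {f : X → ℝ} (hf : Integrable f μ) (a : ℝ) {q : ENNReal} (hq : 1 ≤ q) :
    eLpNorm (fun x => f x - ⨍ y, f y ∂μ) q μ ≤ eLpNorm (fun x => f x - a) q μ +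
      (μ Set.univ)⁻¹ * (∫⁻ x, ‖f x - a‖ₑ ∂μ) * μ Set.univ ^ (1 / q.toReal) := by
  have havg : ‖(⨍ y, f y ∂μ) - a‖ₑ ≤ (μ Set.univ)⁻¹ * ∫⁻ x, ‖f x - a‖ₑ ∂μ := by
    have h1 : (⨍ y, f y ∂μ) - a = ⨍ y, (f y - a) ∂μ := by
      rw [average_eq, average_eq, integral_sub hf (integrable_const a), integral_const, smul_sub,
        smul_smul, inv_mul_cancel₀ ((measureReal_ne_zero_iff (measure_ne_top μ _)).2 (NeZero.ne _)), one_smul]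
    rw [h1, average]
    refine (enorm_integral_le_lintegral_enorm _).trans_eq ?_
    rw [lintegral_smul_measure, smul_eq_mul]
  have hq0 : q ≠ 0 := (zero_lt_one.trans_le hq).ne'
  calc eLpNorm (fun x => f x - ⨍ y, f y ∂μ) q μ
      = eLpNorm ((fun x => f x - a) - fun _ => (⨍ y, f y ∂μ) - a) q μ := by
        congr 1; ext x; simp
    _ ≤ eLpNorm (fun x => f x - a) q μ + eLpNorm (fun _ => (⨍ y, f y ∂μ) - a) q μ :=
        eLpNorm_sub_le (hf.1.sub aestronglyMeasurable_const) aestronglyMeasurable_const hq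
    _ ≤ _ := by
        rw [eLpNorm_const _ hq0 (NeZero.ne μ)]
        gcongr

/-- weighted Poincaré inequality on a bounded `C²` domain:
`‖φ - (φ)‖_{L^p(D)} ≤ C · sup_{x∈D} d_D(x)|∇φ(x)|` for `φ ∈ Ŵ^{1,∞}_d(D)`
(formulated via an arbitrary upper bound `L` of the weighted gradient). -/
theorem stmt1 (n : ℕ) (hn : 2 ≤ n) (D : Set (EuclideanSpace ℝ (Fin n)))
    (hD : IsBoundedCkDomain n 2 D) (p : ℝ) (hp : 1 ≤ p) :
    ∃ C > (0:ℝ), ∀ φ : EuclideanSpace ℝ (Fin n) → ℝ, DifferentiableOn ℝ φ D →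
      ∀ L : ℝ, (∀ x ∈ D, infDist x (frontier D) * ‖fderivWithin ℝ φ D x‖ ≤ L) →
      eLpNorm (fun x => φ x - ⨍ y in D, φ y) (ENNReal.ofReal p) (volume.restrict D)
        ≤ ENNReal.ofReal (C * L) := by
  have hfr := hD.frontier_nonempty (by omega)
  obtain ⟨hopen, hconn, hbdd, -⟩ := id hD
  obtain ⟨x₁, hx₁⟩ := hconn.nonempty
  have hp0 : 0 < p := one_pos.trans_le hp
  obtain ⟨Cp, hCp, HCp⟩ := hD.exists_lintegral_le one_le_two hfr hx₁ hp
  obtain ⟨C₁, hC₁, HC₁⟩ := hD.exists_lintegral_le one_le_two hfr hx₁ le_rfl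
  have hvol : volume D ≠ ⊤ := hbdd.measure_lt_top.ne
  have hvol0 : volume D ≠ 0 := (hopen.measure_pos volume ⟨x₁, hx₁⟩).ne'
  have : IsFiniteMeasure (volume.restrict D) := ⟨by simpa using hvol.lt_top⟩
  have : NeZero (volume.restrict D) := ⟨by simpa using hvol0⟩
  set M : ENNReal := Cp ^ (1 / p) + (volume D)⁻¹ * C₁ * volume D ^ (1 / p) with hM_def
  have hM : M ≠ ⊤ := by
    refine ENNReal.add_ne_top.2 ⟨ENNReal.rpow_ne_top_of_nonneg (by positivity) hCp, ?_⟩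
    exact ENNReal.mul_ne_top (ENNReal.mul_ne_top (ENNReal.inv_ne_top.2 hvol0) hC₁)
      (ENNReal.rpow_ne_top_of_nonneg (by positivity) hvol)
  refine ⟨M.toReal + 1, by positivity, fun φ hdiff L hL => ?_⟩
  have hφ : HasWeightedGradientBound D φ L := ⟨hdiff, hL⟩
  have hp_top : (ENNReal.ofReal p).toReal = p := ENNReal.toReal_ofReal hp0.le
  have hL1 : ∫⁻ x in D, ‖φ x - φ x₁‖ₑ ≤ C₁ * ENNReal.ofReal L := by
    simpa using HC₁ φ L hφ
  have hLp : eLpNorm (fun x => φ x - φ x₁) (ENNReal.ofReal p) (volume.restrict D)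
      ≤ Cp ^ (1 / p) * ENNReal.ofReal L := by
    rw [eLpNorm_eq_lintegral_rpow_enorm_toReal (by simpa using hp0) ENNReal.ofReal_ne_top, hp_top]
    calc _ ≤ (Cp * ENNReal.ofReal L ^ p) ^ (1 / p) := by
          gcongr
          exact HCp φ L hφ
      _ = Cp ^ (1 / p) * ENNReal.ofReal L := by
          rw [ENNReal.mul_rpow_of_nonneg _ _ (by positivity), ← ENNReal.rpow_mul,
            mul_one_div_cancel hp0.ne', ENNReal.rpow_one]
  have hint : Integrable φ (volume.restrict D) := by
    have hsub : Integrable (fun x => φ x - φ x₁) (volume.restrict D) :=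
      ⟨(hdiff.continuousOn.aestronglyMeasurable hopen.measurableSet).sub
        aestronglyMeasurable_const,
        hL1.trans_lt (ENNReal.mul_lt_top hC₁.lt_top ENNReal.ofReal_lt_top)⟩
    exact (hsub.add (integrable_const (φ x₁))).congr (by simp [Filter.EventuallyEq])
  have hmain := eLpNorm_sub_average_le hint (φ x₁) (q := ENNReal.ofReal p)
    (by simpa using ENNReal.ofReal_le_ofReal hp)
  rw [hp_top, Measure.restrict_apply_univ] at hmain
  calc _ ≤ _ := hmain
    _ ≤ Cp ^ (1 / p) * ENNReal.ofReal L +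
        (volume D)⁻¹ * (C₁ * ENNReal.ofReal L) * volume D ^ (1 / p) := by gcongr
    _ = M * ENNReal.ofReal L := by rw [hM_def]; ring
    _ ≤ ENNReal.ofReal (M.toReal + 1) * ENNReal.ofReal L := by
        gcongr
        rw [← ENNReal.ofReal_toReal hM]
        exact ENNReal.ofReal_le_ofReal (by simp)
    _ = _ := (ENNReal.ofReal_mul (by positivity)).symm
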